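/- Ornstein's non-inequality: for every constant C > 0 there exists a smooth compactly supported function φ : ℝ² → ℝ such that ∫_{ℝ²} |∂₁∂₂φ| dx > C ∫_{ℝ²} ( |∂₁²φ| + |∂₂²φ| ) dx. In particular, there is no constant C > 0 such that ‖Hess φ‖_{L¹} ≤ C ‖Δφ‖_{L¹} for all φ ∈ C_c^∞(ℝ²). -/

import Mathlib

open MeasureTheory

/-- Partial derivative `∂ᵢ u` of a function on `ℝⁿ = EuclideanSpace ℝ (Fin n)`. -/
noncomputable def pd {n : ℕ} (u : EuclideanSpace ℝ (Fin n) → ℝ) (i : Fin n)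
    (x : EuclideanSpace ℝ (Fin n)) : ℝ :=
  fderiv ℝ u x (EuclideanSpace.single i 1)

/-- Second partial derivative `∂ᵢ∂ⱼ u`. -/
noncomputable def pd2 {n : ℕ} (u : EuclideanSpace ℝ (Fin n) → ℝ) (i j : Fin n)
    (x : EuclideanSpace ℝ (Fin n)) : ℝ :=
  pd (pd u j) i x

/-- Laplacian `Δu = ∑ᵢ ∂ᵢ² u`. -/
noncomputable def lap {n : ℕ} (u : EuclideanSpace ℝ (Fin n) → ℝ)
    (x : EuclideanSpace ℝ (Fin n)) : ℝ :=
  ∑ i : Fin n, pd2 u i i x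

/-- Euclidean norm of the gradient, `|∇u|(x) = (∑ᵢ (∂ᵢu)²)^{1/2}`. -/
noncomputable def gradNorm {n : ℕ} (u : EuclideanSpace ℝ (Fin n) → ℝ)
    (x : EuclideanSpace ℝ (Fin n)) : ℝ :=
  Real.sqrt (∑ i : Fin n, pd u i x ^ 2)

/-- Hilbert–Schmidt norm of the Hessian, `|Hess u|(x) = (∑_{i,j} (∂ᵢ∂ⱼu)²)^{1/2}`. -/
noncomputable def hessNorm {n : ℕ} (u : EuclideanSpace ℝ (Fin n) → ℝ)
    (x : EuclideanSpace ℝ (Fin n)) : ℝ :=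
  Real.sqrt (∑ i : Fin n, ∑ j : Fin n, pd2 u i j x ^ 2)

/-- `L^p` norm with respect to Lebesgue measure on `ℝⁿ`:  `(∫ |f|^p)^{1/p}`. -/
noncomputable def lpNorm {n : ℕ} (p : ℝ) (f : EuclideanSpace ℝ (Fin n) → ℝ) : ℝ :=
  (∫ x, |f x| ^ p) ^ (1 / p)


abbrev E2 := EuclideanSpace ℝ (Fin 2)

lemma pd_contDiff {u : E2 → ℝ} (hu : ContDiff ℝ (⊤ : ℕ∞) u) (i : Fin 2) :
    ContDiff ℝ (⊤ : ℕ∞) (pd u i) := by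
  have h : ContDiff ℝ (⊤ : ℕ∞) (fderiv ℝ u) := hu.fderiv_right (by simp)
  exact h.clm_apply contDiff_const

lemma pd_supp {u : E2 → ℝ} (hu : HasCompactSupport u) (i : Fin 2) :
    HasCompactSupport (pd u i) :=
  hu.fderiv_apply (𝕜 := ℝ) _

lemma pd_add' {u v : E2 → ℝ} (hu : Differentiable ℝ u) (hv : Differentiable ℝ v) (i : Fin 2) :
    pd (fun x => u x + v x) i = fun x => pd u i x + pd v i x := by
  funext x
  simp only [pd]
  rw [fderiv_fun_add (hu x) (hv x)]; rfl

lemma pd_mul' {u v : E2 → ℝ} (hu : Differentiable ℝ u) (hv : Differentiable ℝ v) (i : Fin 2) :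
    pd (fun x => u x * v x) i = fun x => u x * pd v i x + v x * pd u i x := by
  funext x
  simp only [pd]
  rw [fderiv_fun_mul (hu x) (hv x)]; rfl

lemma pd_cmul {u : E2 → ℝ} (hu : Differentiable ℝ u) (c : ℝ) (i : Fin 2) :
    pd (fun x => c * u x) i = fun x => c * pd u i x := by
  funext x
  simp only [pd]
  rw [fderiv_const_mul (hu x)]; rfl

lemma hasF (N : ℝ) (w x : E2) : HasFDerivAt (fun x : E2 => N * inner ℝ w x) (N • innerSL ℝ w) x := by
  exact ((innerSL ℝ w).hasFDerivAt (x := x)).const_mul N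

lemma pd_cos (N : ℝ) (w : E2) (i : Fin 2) :
    pd (fun x => Real.cos (N * inner ℝ w x)) i = fun x => -(N * w i) * Real.sin (N * inner ℝ w x) := by
  funext x
  simp only [pd]
  rw [(hasF N w x).cos.fderiv]
  simp [EuclideanSpace.inner_single_right]
  ring

lemma pd_sin (N : ℝ) (w : E2) (i : Fin 2) :
    pd (fun x => Real.sin (N * inner ℝ w x)) i = fun x => (N * w i) * Real.cos (N * inner ℝ w x) := by
  funext x
  simp only [pd]
  rw [(hasF N w x).sin.fderiv]
  simp [EuclideanSpace.inner_single_right]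
  ring

lemma cd_cos (N : ℝ) (w : E2) : ContDiff ℝ (⊤ : ℕ∞) (fun x : E2 => Real.cos (N * inner ℝ w x)) :=
  Real.contDiff_cos.comp (contDiff_const.mul (innerSL ℝ w).contDiff)
lemma cd_sin (N : ℝ) (w : E2) : ContDiff ℝ (⊤ : ℕ∞) (fun x : E2 => Real.sin (N * inner ℝ w x)) :=
  Real.contDiff_sin.comp (contDiff_const.mul (innerSL ℝ w).contDiff)

lemma pd2_wave (N : ℝ) (hN : N ≠ 0) (w : E2) {R : E2 → ℝ} (hR : ContDiff ℝ (⊤ : ℕ∞) R) (i j : Fin 2)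
    (x : E2) :
    pd2 (fun x => (-(N⁻¹ ^ 2)) * (Real.cos (N * inner ℝ w x) * R x)) i j x =
      w i * w j * Real.cos (N * inner ℝ w x) * R x +
      N⁻¹ * (w j * Real.sin (N * inner ℝ w x) * pd R i x + w i * Real.sin (N * inner ℝ w x) * pd R j x
        - N⁻¹ * (Real.cos (N * inner ℝ w x) * pd2 R i j x)) := by
  have hd {u : E2 → ℝ} (h : ContDiff ℝ (⊤ : ℕ∞) u) : Differentiable ℝ u := h.differentiable (by simp)
  have hc := hd (cd_cos N w)
  have hs := hd (cd_sin N w)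
  have hRd := hd hR
  have hpR := hd (pd_contDiff hR j)
  have h1 : pd (fun x => (-(N⁻¹ ^ 2)) * (Real.cos (N * inner ℝ w x) * R x)) j =
      fun x => N⁻¹ * w j * (Real.sin (N * inner ℝ w x) * R x) +
        (-(N⁻¹ ^ 2)) * (Real.cos (N * inner ℝ w x) * pd R j x) := by
    rw [pd_cmul (hc.fun_mul hRd), pd_mul' hc hRd, pd_cos]
    funext y
    field_simp
    ring
  simp only [pd2]
  rw [h1, pd_add' ((hs.fun_mul hRd).const_mul _) ((hc.fun_mul hpR).const_mul _),
    pd_cmul (hs.fun_mul hRd), pd_cmul (hc.fun_mul hpR), pd_mul' hs hRd, pd_mul' hc hpR, pd_cos, pd_sin]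
  dsimp only
  field_simp
  ring

lemma pd2_add {u v : E2 → ℝ} (hu : ContDiff ℝ (⊤ : ℕ∞) u) (hv : ContDiff ℝ (⊤ : ℕ∞) v) (i j : Fin 2)
    (x : E2) : pd2 (fun x => u x + v x) i j x = pd2 u i j x + pd2 v i j x := by
  have hd {u : E2 → ℝ} (h : ContDiff ℝ (⊤ : ℕ∞) u) : Differentiable ℝ u := h.differentiable (by simp)
  simp only [pd2]
  rw [pd_add' (hd hu) (hd hv), pd_add' (hd (pd_contDiff hu j)) (hd (pd_contDiff hv j))]

lemma pd2_cont {u : E2 → ℝ} (hu : ContDiff ℝ (⊤ : ℕ∞) u) (i j : Fin 2) : Continuous (pd2 u i j) :=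
  (pd_contDiff (pd_contDiff hu j) i).continuous

lemma pd2_supp {u : E2 → ℝ} (hu : HasCompactSupport u) (i j : Fin 2) : HasCompactSupport (pd2 u i j) :=
  pd_supp (pd_supp hu j) i

lemma pd2_int {u : E2 → ℝ} (hu : ContDiff ℝ (⊤ : ℕ∞) u) (hs : HasCompactSupport u) (i j : Fin 2) :
    Integrable (pd2 u i j) :=
  (pd2_cont hu i j).integrable_of_hasCompactSupport (pd2_supp hs i j)

lemma pd_int {u : E2 → ℝ} (hu : ContDiff ℝ (⊤ : ℕ∞) u) (hs : HasCompactSupport u) (i : Fin 2) :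
    Integrable (pd u i) :=
  (pd_contDiff hu i).continuous.integrable_of_hasCompactSupport (pd_supp hs i)

/-- Riemann-Lebesgue, exponential form. -/
lemma rl_exp (w : E2) (hw : w ≠ 0) (F : E2 → ℂ) :
    Filter.Tendsto (fun n : ℕ => ∫ x, Complex.exp (Complex.I * ((n : ℝ) * inner ℝ w x : ℝ)) * F x)
      Filter.atTop (nhds 0) := by
  have h := tendsto_integral_exp_inner_smul_cocompact (V := E2) F
  have h2 : Filter.Tendsto (fun n : ℕ => (-((n : ℝ) / (2 * Real.pi))) • w) Filter.atTop
      (Filter.cocompact E2) := by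
    rw [← Metric.cobounded_eq_cocompact, ← comap_norm_atTop, Filter.tendsto_comap_iff]
    have : (norm ∘ fun n : ℕ => (-((n : ℝ) / (2 * Real.pi))) • w) =
        fun n : ℕ => (n : ℝ) * (‖w‖ / (2 * Real.pi)) := by
      funext n
      simp [norm_smul, abs_of_pos Real.pi_pos]
      ring
    rw [this]
    exact tendsto_natCast_atTop_atTop.atTop_mul_const (by have := norm_pos_iff.2 hw; positivity)
  refine (h.comp h2).congr fun n => ?_
  simp only [Function.comp]
  congr 1
  funext x
  rw [Circle.smul_def, Real.fourierChar_apply, smul_eq_mul]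
  congr 2
  rw [inner_smul_right, real_inner_comm]
  push_cast
  have : (Real.pi : ℂ) ≠ 0 := by exact_mod_cast Real.pi_ne_zero
  field_simp

lemma rl_cos (w : E2) (hw : w ≠ 0) (F : E2 → ℂ) (hF : Integrable F) (k : ℕ) (hk : 0 < k) :
    Filter.Tendsto (fun n : ℕ => ∫ x, (Real.cos (k * ((n : ℝ) * inner ℝ w x)) : ℂ) * F x)
      Filter.atTop (nhds 0) := by
  have hk' : (k : ℝ) ≠ 0 := by positivity
  have h1 := rl_exp ((k : ℝ) • w) (by simp [hk.ne', hw]) F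
  have h2 := rl_exp (-((k : ℝ) • w)) (by simp [hk.ne', hw]) F
  have h := (h1.add h2).div_const 2
  simp only [add_zero, zero_div] at h
  refine h.congr fun n => ?_
  have hi (w : E2) : Integrable fun x => Complex.exp (Complex.I * ((n : ℝ) * inner ℝ w x : ℝ)) * F x := by
    refine hF.bdd_mul (c := 1) (Continuous.aestronglyMeasurable (by fun_prop)) (Filter.Eventually.of_forall fun x => ?_)
    rw [mul_comm, Complex.norm_exp_ofReal_mul_I]
  rw [← integral_add (hi _) (hi _), ← integral_div]
  congr 1
  funext x
  rw [Complex.ofReal_cos, Complex.cos]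
  simp only [inner_neg_left, real_inner_smul_left]
  push_cast
  have e1 : Complex.I * ((n:ℂ) * (k * (inner ℝ w x : ℝ))) = k * (n * (inner ℝ w x : ℝ)) * Complex.I := by ring
  have e2 : Complex.I * ((n:ℂ) * -(k * (inner ℝ w x : ℝ))) = -(k * (n * (inner ℝ w x : ℝ))) * Complex.I := by ring
  rw [e1, e2]
  ring

lemma rl_one (w : E2) (hw : w ≠ 0) (F : E2 → ℂ) (hF : Integrable F) :
    Filter.Tendsto (fun n : ℕ => ∫ x, (Real.cos ((n : ℝ) * inner ℝ w x) : ℂ) * F x)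
      Filter.atTop (nhds 0) := by
  simpa using rl_cos w hw F hF 1 one_pos

lemma int_cos (w : E2) (N : ℝ) (F : E2 → ℂ) (hF : Integrable F) :
    Integrable fun x => (Real.cos (N * inner ℝ w x) : ℂ) * F x := by
  refine hF.bdd_mul (c := 1) (Continuous.aestronglyMeasurable (by fun_prop)) (Filter.Eventually.of_forall fun x => ?_)
  rw [Complex.norm_real]
  exact Real.abs_cos_le_one _

lemma rl_sq (w : E2) (hw : w ≠ 0) (F : E2 → ℂ) (hF : Integrable F) :
    Filter.Tendsto (fun n : ℕ => ∫ x, (Real.cos ((n : ℝ) * inner ℝ w x) : ℂ) *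
      ((Real.cos ((n : ℝ) * inner ℝ w x) : ℂ) * F x))
      Filter.atTop (nhds ((∫ x, F x) / 2)) := by
  have h := ((rl_cos w hw F hF 2 two_pos).add_const (∫ x, F x)).div_const 2
  rw [zero_add] at h
  refine h.congr fun n => ?_
  have hi : Integrable fun x => (Real.cos ((2:ℕ) * ((n : ℝ) * inner ℝ w x)) : ℂ) * F x := by
    simpa [mul_assoc] using int_cos w (2 * n) F hF
  rw [← integral_add hi hF, ← integral_div]
  congr 1
  funext x
  push_cast
  rw [Complex.cos_two_mul]
  ring

/-- The oscillating corrector. -/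
noncomputable def wave (w : E2) (R : E2 → ℝ) (n : ℕ) : E2 → ℝ :=
  fun x => (-((n : ℝ)⁻¹ ^ 2)) * (Real.cos ((n : ℝ) * inner ℝ w x) * R x)

lemma wave_cd (w : E2) {R : E2 → ℝ} (hR : ContDiff ℝ (⊤ : ℕ∞) R) (n : ℕ) :
    ContDiff ℝ (⊤ : ℕ∞) (wave w R n) :=
  contDiff_const.mul ((cd_cos n w).mul hR)

lemma wave_supp (w : E2) {R : E2 → ℝ} (hR : HasCompactSupport R) (n : ℕ) :
    HasCompactSupport (wave w R n) := by
  unfold wave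
  exact (hR.mul_left (f := fun x => Real.cos ((n : ℝ) * inner ℝ w x))).mul_left
    (f := fun _ => (-((n : ℝ)⁻¹ ^ 2)))

/-- The remainder. -/
noncomputable def werr (w : E2) (R : E2 → ℝ) (i j : Fin 2) (n : ℕ) : E2 → ℝ :=
  fun x => pd2 (wave w R n) i j x - w i * w j * (Real.cos ((n : ℝ) * inner ℝ w x) * R x)

lemma werr_cont (w : E2) {R : E2 → ℝ} (hR : ContDiff ℝ (⊤ : ℕ∞) R) (i j : Fin 2) (n : ℕ) :
    Continuous (werr w R i j n) :=
  (pd2_cont (wave_cd w hR n) i j).sub (continuous_const.mul ((cd_cos n w).continuous.mul hR.continuous))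

lemma werr_int (w : E2) {R : E2 → ℝ} (hR : ContDiff ℝ (⊤ : ℕ∞) R) (hs : HasCompactSupport R)
    (i j : Fin 2) (n : ℕ) : Integrable (werr w R i j n) := by
  refine (pd2_int (wave_cd w hR n) (wave_supp w hs n) i j).sub (Integrable.const_mul ?_ _)
  exact ((cd_cos n w).continuous.mul hR.continuous).integrable_of_hasCompactSupport hs.mul_left

lemma werr_tendsto (w : E2) (hw : ∀ i, |w i| ≤ 1) {R : E2 → ℝ} (hR : ContDiff ℝ (⊤ : ℕ∞) R)
    (hs : HasCompactSupport R) (i j : Fin 2) :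
    Filter.Tendsto (fun n : ℕ => ∫ x, |werr w R i j n x|) Filter.atTop (nhds 0) := by
  set c := ∫ x, (|pd R i x| + |pd R j x| + |pd2 R i j x|) with hc
  have h0 : Filter.Tendsto (fun n : ℕ => (n : ℝ)⁻¹ * c) Filter.atTop (nhds 0) := by
    simpa using (tendsto_inv_atTop_nhds_zero_nat (𝕜 := ℝ)).mul_const c
  refine tendsto_of_tendsto_of_tendsto_of_le_of_le' tendsto_const_nhds h0
    (Filter.Eventually.of_forall fun n => integral_nonneg fun x => abs_nonneg _) ?_
  filter_upwards [Filter.eventually_ge_atTop 1] with n hn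
  have hn1 : (1 : ℝ) ≤ n := by exact_mod_cast hn
  have hni : (n : ℝ)⁻¹ ≤ 1 := inv_le_one_of_one_le₀ hn1
  have hni0 : 0 ≤ (n : ℝ)⁻¹ := by positivity
  rw [hc, ← integral_const_mul]
  refine integral_mono (werr_int w hR hs i j n).abs ?_ fun x => ?_
  · exact Integrable.const_mul (((pd_int hR hs i).abs.add (pd_int hR hs j).abs).add (pd2_int hR hs i j).abs) _
  · dsimp only
    have he : werr w R i j n x = (n : ℝ)⁻¹ * (w j * Real.sin (n * inner ℝ w x) * pd R i x
        + w i * Real.sin (n * inner ℝ w x) * pd R j x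
        - (n : ℝ)⁻¹ * (Real.cos (n * inner ℝ w x) * pd2 R i j x)) := by
      unfold werr wave
      rw [pd2_wave n (by positivity) w hR]
      ring
    rw [he, abs_mul, abs_of_nonneg hni0]
    refine mul_le_mul_of_nonneg_left ?_ hni0
    have k1 (u v : ℝ) (hu : |u| ≤ 1) (p : ℝ) (hv : |v| ≤ 1) : |u * v * p| ≤ |p| := by
      rw [abs_mul, abs_mul]
      exact mul_le_of_le_one_left (abs_nonneg _) (mul_le_one₀ hu (abs_nonneg _) hv)
    have a1 := k1 _ _ (hw j) (pd R i x) (Real.abs_sin_le_one (n * inner ℝ w x))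
    have a2 := k1 _ _ (hw i) (pd R j x) (Real.abs_sin_le_one (n * inner ℝ w x))
    have a3 := k1 (n : ℝ)⁻¹ _ (by rwa [abs_of_nonneg hni0]) (pd2 R i j x)
      (Real.abs_cos_le_one (n * inner ℝ w x))
    rw [mul_assoc] at a3
    exact (abs_sub _ _).trans (add_le_add ((abs_add_le _ _).trans (add_le_add a1 a2)) a3)

/-- The state of the inductive construction. -/
def OState (a : ℝ) (χ : E2 → ℝ) (k : ℕ) (q T : ℂ) (ε : ℝ) : Prop :=
  ∃ (φ R : E2 → ℝ) (P : E2 → ℂ), ContDiff ℝ (⊤ : ℕ∞) φ ∧ HasCompactSupport φ ∧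
    ContDiff ℝ (⊤ : ℕ∞) R ∧ HasCompactSupport R ∧ (∀ x, 0 ≤ R x) ∧ Continuous P ∧
    (∀ x, ‖P x‖ ≤ Real.sqrt (1 + a ^ 2) ^ k) ∧
    (∀ i, ∫ x, |pd2 φ i i x - (R x - χ x)| < ε) ∧
    ‖(∫ x, (R x : ℂ)) - ∫ x, (χ x : ℂ)‖ < ε ∧
    ‖(∫ x, (R x : ℂ) * P x) - q * ∫ x, (χ x : ℂ)‖ < ε ∧
    ‖(∫ x, (pd2 φ 0 1 x : ℂ) * P x) - T * ∫ x, (χ x : ℂ)‖ < ε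

lemma ostep (a : ℝ) (ha : |a| ≤ 1) (χ : E2 → ℝ) (hχ : ContDiff ℝ (⊤ : ℕ∞) χ) (hχs : HasCompactSupport χ)
    (k : ℕ) (q T : ℂ) (ε : ℝ) (hε : 0 < ε) (δ : ℝ) (hδ : δ * δ = 1) (h : OState a χ k q T (ε / 2)) :
    OState a χ (k + 1) (q * (1 + Complex.I * a * δ / 2)) (T + Complex.I * a / 2 * q) ε := by
  obtain ⟨φ, R, P, hφ, hφs, hR, hRs, hR0, hP, hPb, h1, h2, h3, h4⟩ := h
  set w : E2 := !₂[1, δ] with hwdef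
  have w0 : w 0 = 1 := by simp [hwdef]
  have w1 : w 1 = δ := by simp [hwdef]
  have hδ1 : |δ| = 1 := by
    have : |δ| * |δ| = 1 := by rw [← abs_mul, hδ, abs_one]
    nlinarith [abs_nonneg δ]
  have hw0 : w ≠ 0 := by
    intro h
    rw [h] at w0
    simp at w0
  have hw : ∀ i, |w i| ≤ 1 := by
    intro i
    fin_cases i
    · simp [w0]
    · simp [w1, hδ1]
  have hwi : ∀ i, w i * w i = 1 := by
    intro i
    fin_cases i
    · simp [w0]
    · simp [w1, hδ]
  have cC : ∀ n : ℕ, Continuous fun x : E2 => Real.cos ((n : ℝ) * inner ℝ w x) :=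
    fun n => (cd_cos n w).continuous
  have cCC : ∀ n : ℕ, Continuous fun x : E2 => (Real.cos ((n : ℝ) * inner ℝ w x) : ℂ) :=
    fun n => Complex.continuous_ofReal.comp (cC n)
  -- integrability
  have iR : Integrable fun x => (R x : ℂ) :=
    (hR.continuous.integrable_of_hasCompactSupport hRs).ofReal
  have cs (u : E2 → ℝ) (hu : HasCompactSupport u) : HasCompactSupport fun x => (u x : ℂ) :=
    hu.comp_left (g := fun r : ℝ => (r : ℂ)) (by simp)
  have iRP : Integrable fun x => (R x : ℂ) * P x :=
    ((Complex.continuous_ofReal.comp hR.continuous).mul hP).integrable_of_hasCompactSupport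
      (cs R hRs).mul_right
  have ipP : Integrable fun x => (pd2 φ 0 1 x : ℂ) * P x :=
    ((Complex.continuous_ofReal.comp (pd2_cont hφ 0 1)).mul hP).integrable_of_hasCompactSupport
      (cs _ (pd2_supp hφs 0 1)).mul_right
  -- new objects
  let R' : ℕ → E2 → ℝ := fun n x => (1 + Real.cos ((n : ℝ) * inner ℝ w x)) * R x
  let P' : ℕ → E2 → ℂ := fun n x => (1 + Complex.I * a * δ * (Real.cos ((n : ℝ) * inner ℝ w x) : ℂ)) * P x
  let φ' : ℕ → E2 → ℝ := fun n x => φ x + wave w R n x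
  have cP' : ∀ n, Continuous (P' n) := fun n => (continuous_const.add (continuous_const.mul (cCC n))).mul hP
  have bP' : ∀ n x, ‖P' n x‖ ≤ Real.sqrt (1 + a ^ 2) ^ (k + 1) := by
    intro n x
    rw [pow_succ', norm_mul]
    refine mul_le_mul ?_ (hPb x) (norm_nonneg _) (Real.sqrt_nonneg _)
    apply Real.le_sqrt_of_sq_le
    set c := Real.cos ((n : ℝ) * inner ℝ w x) with hc
    have hc1 : c ^ 2 ≤ 1 := Real.cos_sq_le_one _
    have : (1 + Complex.I * a * δ * (c : ℂ)) = ((1 : ℝ) : ℂ) + ((a * δ * c : ℝ) : ℂ) * Complex.I := by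
      push_cast; ring
    rw [this, ← Complex.normSq_eq_norm_sq, Complex.normSq_add_mul_I]
    have h2 : (a * δ * c) ^ 2 = a ^ 2 * c ^ 2 * (δ * δ) := by ring
    rw [h2, hδ]
    nlinarith [sq_nonneg a]
  -- limits
  have L2 : Filter.Tendsto (fun n => ∫ x, (R' n x : ℂ)) Filter.atTop (nhds (∫ x, (R x : ℂ))) := by
    have := (rl_one w hw0 _ iR).const_add (∫ x, (R x : ℂ))
    rw [add_zero] at this
    refine this.congr fun n => ?_
    rw [← integral_add iR (int_cos w n _ iR)]
    congr 1
    funext x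
    simp only [R']
    push_cast
    ring
  have L3 : Filter.Tendsto (fun n => ∫ x, (R' n x : ℂ) * P' n x) Filter.atTop
      (nhds ((1 + Complex.I * a * δ / 2) * ∫ x, (R x : ℂ) * P x)) := by
    have e1 := (rl_one w hw0 _ iRP).const_mul (1 + Complex.I * a * δ)
    have e2 := (rl_sq w hw0 _ iRP).const_mul (Complex.I * a * δ)
    have := (e1.add e2).const_add (∫ x, (R x : ℂ) * P x)
    have e : (∫ x, (R x : ℂ) * P x) + ((1 + Complex.I * a * δ) * 0 +
      Complex.I * a * δ * ((∫ x, (R x : ℂ) * P x) / 2)) = (1 + Complex.I * a * δ / 2) * ∫ x, (R x : ℂ) * P x := by ring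
    rw [e] at this
    refine this.congr fun n => ?_
    have i1 := int_cos w n _ iRP
    have i2 := int_cos w n _ i1
    rw [← integral_const_mul, ← integral_const_mul, ← integral_add (i1.const_mul _) (i2.const_mul _),
      ← integral_add iRP ((i1.const_mul _).fun_add (i2.const_mul _))]
    congr 1
    funext x
    simp only [R', P']
    push_cast
    ring
  have iE : ∀ n, Integrable fun x => (werr w R 0 1 n x : ℂ) * P' n x := by
    intro n
    have : Integrable fun x => (werr w R 0 1 n x : ℂ) := (werr_int w hR hRs 0 1 n).ofReal
    exact this.mul_bdd (c := Real.sqrt (1 + a ^ 2) ^ (k + 1)) (cP' n).aestronglyMeasurable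
      (Filter.Eventually.of_forall (bP' n))
  have LE : Filter.Tendsto (fun n => ∫ x, (werr w R 0 1 n x : ℂ) * P' n x) Filter.atTop (nhds 0) := by
    have := (werr_tendsto w hw hR hRs 0 1).mul_const (Real.sqrt (1 + a ^ 2) ^ (k + 1))
    rw [zero_mul] at this
    refine squeeze_zero_norm (fun n => ?_) this
    rw [← integral_mul_const]
    refine norm_integral_le_of_norm_le ((werr_int w hR hRs 0 1 n).abs.mul_const _)
      (Filter.Eventually.of_forall fun x => ?_)
    rw [norm_mul, Complex.norm_real, Real.norm_eq_abs]
    exact mul_le_mul_of_nonneg_left (bP' n x) (abs_nonneg _)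
  have p2 : ∀ n i j x, pd2 (φ' n) i j x = pd2 φ i j x + (w i * w j * (Real.cos ((n : ℝ) * inner ℝ w x) * R x) +
      werr w R i j n x) := by
    intro n i j x
    simp only [φ']
    rw [pd2_add hφ (wave_cd w hR n)]
    simp only [werr]
    ring
  have L4 : Filter.Tendsto (fun n => ∫ x, (pd2 (φ' n) 0 1 x : ℂ) * P' n x) Filter.atTop
      (nhds ((∫ x, (pd2 φ 0 1 x : ℂ) * P x) + Complex.I * a / 2 * ∫ x, (R x : ℂ) * P x)) := by
    have e1 := (rl_one w hw0 _ ipP).const_mul (Complex.I * a * δ)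
    have e2 := (rl_one w hw0 _ iRP).const_mul (δ : ℂ)
    have e3 := (rl_sq w hw0 _ iRP).const_mul (Complex.I * a)
    have := (((e1.add e2).add e3).add LE).const_add (∫ x, (pd2 φ 0 1 x : ℂ) * P x)
    have e : (∫ x, (pd2 φ 0 1 x : ℂ) * P x) + (Complex.I * a * δ * 0 + δ * 0 +
      Complex.I * a * ((∫ x, (R x : ℂ) * P x) / 2) + 0) =
        (∫ x, (pd2 φ 0 1 x : ℂ) * P x) + Complex.I * a / 2 * ∫ x, (R x : ℂ) * P x := by ring
    rw [e] at this
    refine this.congr fun n => ?_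
    have i0 := (int_cos w n _ ipP).const_mul (Complex.I * a * δ)
    have i1 := int_cos w n _ iRP
    have i2 := (int_cos w n _ i1).const_mul (Complex.I * a)
    have i1' := i1.const_mul (δ : ℂ)
    rw [← integral_const_mul, ← integral_const_mul, ← integral_const_mul, ← integral_add i0 i1',
      ← integral_add (i0.fun_add i1') i2, ← integral_add ((i0.fun_add i1').fun_add i2) (iE n),
      ← integral_add ipP (((i0.fun_add i1').fun_add i2).fun_add (iE n))]
    congr 1
    funext x
    rw [p2, w0, w1]
    simp only [P']
    have hδc : (δ : ℂ) * δ = 1 := by exact_mod_cast hδ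
    push_cast
    linear_combination (-Complex.I * a * Complex.cos (n * (inner ℝ w x : ℝ)) ^ 2 * R x * P x) * hδc
  have L1 : ∀ i, Filter.Tendsto (fun n => (∫ x, |pd2 φ i i x - (R x - χ x)|) + ∫ x, |werr w R i i n x|)
      Filter.atTop (nhds (∫ x, |pd2 φ i i x - (R x - χ x)|)) := by
    intro i
    simpa using (werr_tendsto w hw hR hRs i i).const_add (∫ x, |pd2 φ i i x - (R x - χ x)|)
  have E1 : ∀ i, ∀ᶠ n in Filter.atTop, (∫ x, |pd2 φ i i x - (R x - χ x)|) + ∫ x, |werr w R i i n x| < ε :=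
    fun i => (L1 i).eventually_lt_const (by linarith [h1 i])
  have E2 : ∀ᶠ n in Filter.atTop, ‖(∫ x, (R' n x : ℂ)) - ∫ x, (χ x : ℂ)‖ < ε :=
    (L2.sub_const _).norm.eventually_lt_const (by linarith)
  have hIa : ‖Complex.I * (a : ℂ) / 2‖ ≤ 1 / 2 := by
    simp only [norm_div, norm_mul, Complex.norm_I, Complex.norm_real, Real.norm_eq_abs, Complex.norm_ofNat]
    linarith
  have hIad : ‖1 + Complex.I * (a : ℂ) * δ / 2‖ ≤ 3 / 2 := by
    refine (norm_add_le _ _).trans ?_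
    simp only [norm_div, norm_mul, Complex.norm_I, Complex.norm_real, Real.norm_eq_abs, Complex.norm_ofNat,
      hδ1, norm_one]
    linarith
  have E3 : ∀ᶠ n in Filter.atTop, ‖(∫ x, (R' n x : ℂ) * P' n x) -
      q * (1 + Complex.I * a * δ / 2) * ∫ x, (χ x : ℂ)‖ < ε := by
    refine (L3.sub_const _).norm.eventually_lt_const ?_
    have e : (1 + Complex.I * a * δ / 2) * (∫ x, (R x : ℂ) * P x) -
      q * (1 + Complex.I * a * δ / 2) * ∫ x, (χ x : ℂ) =
      (1 + Complex.I * a * δ / 2) * ((∫ x, (R x : ℂ) * P x) - q * ∫ x, (χ x : ℂ)) := by ring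
    rw [e, norm_mul]
    nlinarith [norm_nonneg ((∫ x, (R x : ℂ) * P x) - q * ∫ x, (χ x : ℂ))]
  have E4 : ∀ᶠ n in Filter.atTop, ‖(∫ x, (pd2 (φ' n) 0 1 x : ℂ) * P' n x) -
      (T + Complex.I * a / 2 * q) * ∫ x, (χ x : ℂ)‖ < ε := by
    refine (L4.sub_const _).norm.eventually_lt_const ?_
    have e : (∫ x, (pd2 φ 0 1 x : ℂ) * P x) + Complex.I * a / 2 * (∫ x, (R x : ℂ) * P x) -
      (T + Complex.I * a / 2 * q) * ∫ x, (χ x : ℂ) =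
      ((∫ x, (pd2 φ 0 1 x : ℂ) * P x) - T * ∫ x, (χ x : ℂ)) +
      (Complex.I * a / 2) * ((∫ x, (R x : ℂ) * P x) - q * ∫ x, (χ x : ℂ)) := by ring
    rw [e]
    refine (norm_add_le _ _).trans_lt ?_
    rw [norm_mul]
    nlinarith [norm_nonneg ((∫ x, (R x : ℂ) * P x) - q * ∫ x, (χ x : ℂ))]
  obtain ⟨n, hn0, hn1, hn2, hn3, hn4⟩ := ((E1 0).and ((E1 1).and (E2.and (E3.and E4)))).exists
  refine ⟨φ' n, R' n, P' n, hφ.add (wave_cd w hR n), hφs.add (wave_supp w hRs n),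
    (contDiff_const.add (cd_cos n w)).mul hR, hRs.mul_left, ?_, cP' n, bP' n, ?_, hn2, hn3, hn4⟩
  · intro x
    exact mul_nonneg (by linarith [Real.neg_one_le_cos ((n : ℝ) * inner ℝ w x)]) (hR0 x)
  · intro i
    have hn : (∫ x, |pd2 φ i i x - (R x - χ x)|) + ∫ x, |werr w R i i n x| < ε := by
      fin_cases i
      · exact hn0
      · exact hn1
    refine lt_of_le_of_lt ?_ hn
    have j1 : Integrable fun x => pd2 φ i i x - (R x - χ x) :=
      (pd2_int hφ hφs i i).sub ((hR.continuous.integrable_of_hasCompactSupport hRs).sub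
        (hχ.continuous.integrable_of_hasCompactSupport hχs))
    have j2 := werr_int w hR hRs i i n
    rw [← integral_add j1.abs j2.abs]
    refine integral_mono_of_nonneg (Filter.Eventually.of_forall fun x => abs_nonneg _) (j1.abs.add j2.abs)
      (Filter.Eventually.of_forall fun x => ?_)
    have : pd2 (φ' n) i i x - (R' n x - χ x) = (pd2 φ i i x - (R x - χ x)) + werr w R i i n x := by
      rw [p2, hwi]
      simp only [R']
      ring
    simp only [this]
    exact abs_add_le _ _

noncomputable def qs (a : ℝ) : ℕ → ℂ
  | 0 => 1
  | k + 1 => qs a k * (1 + Complex.I * a * (((-1 : ℝ) ^ k : ℝ) : ℂ) / 2)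

noncomputable def Ts (a : ℝ) : ℕ → ℂ
  | 0 => 0
  | k + 1 => Ts a k + Complex.I * a / 2 * qs a k

lemma qs_form (a : ℝ) (m : ℕ) : ∃ r : ℝ, 1 ≤ r ∧ qs a (2 * m) = r ∧
    qs a (2 * m + 1) = r * (1 + Complex.I * a / 2) := by
  induction m with
  | zero => exact ⟨1, le_rfl, by simp [qs], by simp [qs]⟩
  | succ m ih =>
    obtain ⟨r, hr, h1, h2⟩ := ih
    have hodd : ((-1 : ℝ)) ^ (2 * m + 1) = -1 := by rw [pow_succ, pow_mul]; simp
    have heven : ((-1 : ℝ)) ^ (2 * m + 1 + 1) = 1 := by rw [pow_succ, hodd]; simp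
    have key : qs a (2 * m + 1 + 1) = ((r * (1 + a ^ 2 / 4) : ℝ) : ℂ) := by
      rw [qs, h2, hodd]
      push_cast
      linear_combination (-(r : ℂ) * a ^ 2 / 4) * Complex.I_sq
    refine ⟨r * (1 + a ^ 2 / 4), by nlinarith [sq_nonneg a], key, ?_⟩
    change qs a (2 * m + 1 + 1 + 1) = _
    rw [qs, key, heven]
    simp

lemma qs_re (a : ℝ) (k : ℕ) : 1 ≤ (qs a k).re := by
  obtain ⟨m, rfl | rfl⟩ := Nat.even_or_odd' k
  · obtain ⟨r, hr, h1, h2⟩ := qs_form a m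
    rw [h1]; simpa using hr
  · obtain ⟨r, hr, h1, h2⟩ := qs_form a m
    rw [h2]; simpa using hr

lemma Ts_im (a : ℝ) (ha : 0 ≤ a) (k : ℕ) : k * (a / 2) ≤ (Ts a k).im := by
  induction k with
  | zero => simp [Ts]
  | succ k ih =>
    have h : (Complex.I * a / 2 * qs a k).im = a / 2 * (qs a k).re := by
      have : Complex.I * a / 2 * qs a k = ((a / 2 : ℝ) : ℂ) * (Complex.I * qs a k) := by push_cast; ring
      rw [this, Complex.im_ofReal_mul, Complex.I_mul_im]
    rw [Ts, Complex.add_im, h]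
    push_cast
    nlinarith [qs_re a k]

lemma ostate_all (a : ℝ) (ha : |a| ≤ 1) (χ : E2 → ℝ) (hχ : ContDiff ℝ (⊤ : ℕ∞) χ)
    (hχs : HasCompactSupport χ) (hχ0 : ∀ x, 0 ≤ χ x) (k : ℕ) :
    ∀ ε : ℝ, 0 < ε → OState a χ k (qs a k) (Ts a k) ε := by
  induction k with
  | zero =>
    intro ε hε
    have z : ∀ i j x, pd2 (fun _ : E2 => (0 : ℝ)) i j x = 0 := by
      intro i j x
      have : pd (fun _ : E2 => (0 : ℝ)) j = fun _ => 0 := by funext y; simp [pd]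
      rw [pd2, this]; simp [pd]
    refine ⟨fun _ => 0, χ, fun _ => 1, contDiff_const, HasCompactSupport.zero, hχ, hχs, hχ0,
      continuous_const, by simp, ?_, ?_, ?_, ?_⟩
    · intro i; simpa [z] using hε
    · simpa using hε
    · simpa [qs] using hε
    · simpa [z, Ts] using hε
  | succ k ih =>
    intro ε hε
    exact ostep a ha χ hχ hχs k _ _ ε hε ((-1) ^ k) (by rw [← mul_pow]; simp) (ih _ (half_pos hε))

lemma ornstein_part (C : ℝ) (hC : 0 < C) : ∃ φ : E2 → ℝ,
      ContDiff ℝ (⊤ : ℕ∞) φ ∧ HasCompactSupport φ ∧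
      (∫ x, |pd2 φ 0 1 x|) > C * ∫ x, (|pd2 φ 0 0 x| + |pd2 φ 1 1 x|) := by
  obtain ⟨n, hn⟩ := exists_nat_gt (32 * C + 2)
  have hn2 : (2 : ℝ) < n := by linarith
  have hnp : (0 : ℝ) < n := by linarith
  let b : ContDiffBump (0 : E2) := ⟨1, 2, one_pos, one_lt_two⟩
  let χ : E2 → ℝ := fun x => b x
  have hχ : ContDiff ℝ (⊤ : ℕ∞) χ := b.contDiff
  have hχs : HasCompactSupport χ := b.hasCompactSupport
  have hχ0 : ∀ x, 0 ≤ χ x := fun x => b.nonneg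
  set I := ∫ x, χ x with hI
  have hIp : 0 < I := b.integral_pos
  have hIc : ∫ x, (χ x : ℂ) = (I : ℂ) := integral_ofReal
  set a : ℝ := (n : ℝ)⁻¹ with hadef
  have ha0 : 0 ≤ a := by positivity
  have ha1 : |a| ≤ 1 := by rw [abs_of_nonneg ha0]; exact inv_le_one_of_one_le₀ (by linarith)
  obtain ⟨φ, R, P, hφ, hφs, hR, hRs, hR0, hP, hPb, h1, h2, -, h4⟩ :=
    ostate_all a ha1 χ hχ hχs hχ0 (n * n) I hIp
  refine ⟨φ, hφ, hφs, ?_⟩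
  have iχ : Integrable χ := hχ.continuous.integrable_of_hasCompactSupport hχs
  have iR : Integrable R := hR.continuous.integrable_of_hasCompactSupport hRs
  have hB : Real.sqrt (1 + a ^ 2) ^ (n * n) ≤ 2 := by
    apply abs_le_of_sq_le_sq' _ (by norm_num) |>.2
    rw [← pow_mul, mul_comm, pow_mul, Real.sq_sqrt (by positivity)]
    have e1 : 1 + a ^ 2 ≤ Real.exp (a ^ 2) := by linarith [Real.add_one_le_exp (a ^ 2)]
    calc (1 + a ^ 2) ^ (n * n) ≤ Real.exp (a ^ 2) ^ (n * n) := by gcongr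
      _ = Real.exp 1 := by
        rw [← Real.exp_nat_mul]
        congr 1
        push_cast
        rw [hadef]
        field_simp
      _ ≤ 2 ^ 2 := by linarith [Real.exp_one_lt_d9]
  -- upper bound
  have hRI : ∫ x, R x < 2 * I := by
    have e : (∫ x, (R x : ℂ)) = ((∫ x, R x : ℝ) : ℂ) := integral_ofReal
    rw [e, hIc, ← Complex.ofReal_sub, Complex.norm_real, Real.norm_eq_abs] at h2
    linarith [(abs_lt.1 h2).2]
  have U : ∀ i, ∫ x, |pd2 φ i i x| ≤ 4 * I := by
    intro i
    have i0 : Integrable fun x => |pd2 φ i i x - (R x - χ x)| := ((pd2_int hφ hφs i i).sub (iR.sub iχ)).abs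
    have : ∫ x, |pd2 φ i i x| ≤ ∫ x, (|pd2 φ i i x - (R x - χ x)| + (R x + χ x)) := by
      refine integral_mono (pd2_int hφ hφs i i).abs (i0.add (iR.add iχ)) fun x => ?_
      have t := abs_add_le (pd2 φ i i x - (R x - χ x)) (R x - χ x)
      have t2 : |R x - χ x| ≤ R x + χ x := by
        rw [abs_le]; constructor <;> linarith [hR0 x, hχ0 x]
      rw [sub_add_cancel] at t
      dsimp only
      linarith
    rw [integral_add i0 (iR.fun_add iχ), integral_add iR iχ] at this
    linarith [h1 i]
  have U2 : ∫ x, (|pd2 φ 0 0 x| + |pd2 φ 1 1 x|) ≤ 8 * I := by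
    rw [integral_add (pd2_int hφ hφs 0 0).abs (pd2_int hφ hφs 1 1).abs]
    linarith [U 0, U 1]
  -- lower bound
  have L1 : ‖∫ x, (pd2 φ 0 1 x : ℂ) * P x‖ ≤ (∫ x, |pd2 φ 0 1 x|) * 2 := by
    rw [← integral_mul_const]
    refine norm_integral_le_of_norm_le ((pd2_int hφ hφs 0 1).abs.mul_const _)
      (Filter.Eventually.of_forall fun x => ?_)
    rw [norm_mul, Complex.norm_real, Real.norm_eq_abs]
    exact mul_le_mul_of_nonneg_left ((hPb x).trans hB) (abs_nonneg _)
  have L2 : (n / 2 : ℝ) * I ≤ ‖Ts a (n * n) * ∫ x, (χ x : ℂ)‖ := by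
    rw [hIc, norm_mul, Complex.norm_real, Real.norm_eq_abs, abs_of_pos hIp]
    refine mul_le_mul_of_nonneg_right ?_ hIp.le
    have t := Ts_im a ha0 (n * n)
    have t2 : ((n * n : ℕ) : ℝ) * (a / 2) = n / 2 := by
      push_cast; rw [hadef]; field_simp
    rw [t2] at t
    exact t.trans ((le_abs_self _).trans (Complex.abs_im_le_norm _))
  have L3 := norm_sub_norm_le (Ts a (n * n) * ∫ x, (χ x : ℂ)) (∫ x, (pd2 φ 0 1 x : ℂ) * P x)
  rw [norm_sub_rev] at L3
  have fin1 : C * ∫ x, (|pd2 φ 0 0 x| + |pd2 φ 1 1 x|) ≤ C * (8 * I) := mul_le_mul_of_nonneg_left U2 hC.le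
  have fin2 : (32 * C + 2) * I < n * I := mul_lt_mul_of_pos_right hn hIp
  nlinarith

/-- Ornstein's non-inequality on `ℝ²`: for every `C > 0` there is `φ ∈ C_c^∞(ℝ²)` with
`∫ |∂₁∂₂φ| > C ∫ (|∂₁²φ| + |∂₂²φ|)`; in particular no constant `C > 0` satisfies
`‖Hess φ‖_{L¹} ≤ C ‖Δφ‖_{L¹}` for all `φ ∈ C_c^∞(ℝ²)`. -/
theorem ornstein_non_inequality :
    (∀ C : ℝ, 0 < C → ∃ φ : EuclideanSpace ℝ (Fin 2) → ℝ,
      ContDiff ℝ (⊤ : ℕ∞) φ ∧ HasCompactSupport φ ∧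
      (∫ x, |pd2 φ 0 1 x|) > C * ∫ x, (|pd2 φ 0 0 x| + |pd2 φ 1 1 x|)) ∧
    ¬ ∃ C : ℝ, 0 < C ∧ ∀ φ : EuclideanSpace ℝ (Fin 2) → ℝ,
      ContDiff ℝ (⊤ : ℕ∞) φ → HasCompactSupport φ →
      lpNorm 1 (hessNorm φ) ≤ C * lpNorm 1 (lap φ) := by
  refine ⟨ornstein_part, ?_⟩
  rintro ⟨C, hC, h⟩
  obtain ⟨φ, hφ, hφs, hlt⟩ := ornstein_part C hC
  have h := h φ hφ hφs
  simp only [_root_.lpNorm, Real.rpow_one, div_one] at h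
  have i00 := pd2_int hφ hφs 0 0
  have i11 := pd2_int hφ hφs 1 1
  have hl : ∀ x, lap φ x = pd2 φ 0 0 x + pd2 φ 1 1 x := fun x => by simp [lap]
  have h1 : ∫ x, |lap φ x| ≤ ∫ x, (|pd2 φ 0 0 x| + |pd2 φ 1 1 x|) := by
    simp only [hl]
    exact integral_mono (i00.add i11).abs (i00.abs.add i11.abs) fun x => abs_add_le _ _
  have hc : Continuous (hessNorm φ) := by
    unfold hessNorm
    exact Real.continuous_sqrt.comp (continuous_finsetSum _ fun i _ => continuous_finsetSum _ fun j _ =>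
      (pd2_cont hφ i j).pow 2)
  have hb : ∀ x, |hessNorm φ x| ≤ ∑ i : Fin 2, ∑ j : Fin 2, |pd2 φ i j x| := by
    intro x
    rw [hessNorm, abs_of_nonneg (Real.sqrt_nonneg _)]
    apply Real.sqrt_le_iff.2
    refine ⟨by positivity, ?_⟩
    simp only [Fin.sum_univ_two]
    rw [← sq_abs (pd2 φ 0 0 x), ← sq_abs (pd2 φ 0 1 x), ← sq_abs (pd2 φ 1 0 x), ← sq_abs (pd2 φ 1 1 x)]
    have p0 := abs_nonneg (pd2 φ 0 0 x)
    have p1 := abs_nonneg (pd2 φ 0 1 x)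
    have p2 := abs_nonneg (pd2 φ 1 0 x)
    have p3 := abs_nonneg (pd2 φ 1 1 x)
    nlinarith [mul_nonneg p0 p1, mul_nonneg p0 p2, mul_nonneg p0 p3, mul_nonneg p1 p2,
      mul_nonneg p1 p3, mul_nonneg p2 p3]
  have hi : Integrable (hessNorm φ) := by
    refine Integrable.mono' (integrable_finsetSum _ fun i _ => integrable_finsetSum _ fun j _ =>
      (pd2_int hφ hφs i j).abs) hc.aestronglyMeasurable (Filter.Eventually.of_forall hb)
  have h2 : ∫ x, |pd2 φ 0 1 x| ≤ ∫ x, |hessNorm φ x| := by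
    refine integral_mono (pd2_int hφ hφs 0 1).abs hi.abs fun x => ?_
    dsimp only
    rw [hessNorm, abs_of_nonneg (Real.sqrt_nonneg _)]
    apply Real.abs_le_sqrt
    simp only [Fin.sum_univ_two]
    nlinarith [sq_nonneg (pd2 φ 0 0 x), sq_nonneg (pd2 φ 1 0 x), sq_nonneg (pd2 φ 1 1 x)]
  have h3 := mul_le_mul_of_nonneg_left h1 hC.le
  linarith
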